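/- arXiv:2204.12589 — 4 statements merged into one kernel-verified Lean document; each statement's English description precedes it below -/
import Mathlib

section
/- (Proposition: Stan does not saturate.) If β ≠ 0, then the Stan activation function σ_β(x) = tanh(x) + β·x·tanh(x) does not saturate: its derivative σ_β' does not tend to 0 as x → +∞ and does not tend to 0 as x → −∞. -/
theorem stan_deriv_aux (β x : ℝ) :
    deriv (fun x : ℝ => Real.tanh x + β * x * Real.tanh x) x
      = (1 + β * x) / Real.cosh x ^ 2 + β * Real.tanh x := by
  have hc : Real.cosh x ≠ 0 := (Real.cosh_pos x).ne'
  have ht : HasDerivAt Real.tanh (1 / Real.cosh x ^ 2) x := by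
    have h := (Real.hasDerivAt_sinh x).div (Real.hasDerivAt_cosh x) hc
    have e : Real.tanh = Real.sinh / Real.cosh := by
      funext y
      simp [Real.tanh_eq_sinh_div_cosh]
    rw [e]
    have e2 : Real.cosh x * Real.cosh x - Real.sinh x * Real.sinh x = 1 := by
      rw [← Real.cosh_sq_sub_sinh_sq x]
      ring
    rw [e2] at h
    exact h
  have h2 := ht.add (((hasDerivAt_id x).const_mul β).mul ht)
  have h3 := h2.deriv
  refine Eq.trans h3 ?_
  simp only [id]
  ring

theorem stan_tendsto_aux (β : ℝ) :
    Filter.Tendsto (fun x : ℝ => (1 + β * x) / Real.cosh x ^ 2 + β * Real.tanh x)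
      Filter.atTop (nhds β) := by
  have hu : Filter.Tendsto (fun x : ℝ => Real.exp (-x)) Filter.atTop (nhds 0) :=
    Real.tendsto_exp_neg_atTop_nhds_zero
  have hxu : Filter.Tendsto (fun x : ℝ => x * Real.exp (-x)) Filter.atTop (nhds 0) := by
    simpa using Real.tendsto_pow_mul_exp_neg_atTop_nhds_zero 1
  have hd : Filter.Tendsto (fun x : ℝ => 1 + Real.exp (-x) ^ 2) Filter.atTop (nhds 1) := by
    simpa using (hu.pow 2).const_add 1
  have h1 := (((hu.pow 2).add ((hxu.mul hu).const_mul β)).const_mul 4).div (hd.pow 2) (by norm_num)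
  have h2 := (((hu.pow 2).const_sub 1).div hd (by norm_num)).const_mul β
  have h := h1.add h2
  have e : (4 * ((0:ℝ) ^ 2 + β * (0 * 0)) / 1 ^ 2 + β * ((1 - 0 ^ 2) / 1)) = β := by ring
  rw [e] at h
  refine h.congr fun x => ?_
  have hp := Real.exp_pos (-x)
  have hx : Real.exp x = (Real.exp (-x))⁻¹ := by rw [Real.exp_neg, inv_inv]
  simp only [Pi.div_apply]
  rw [Real.tanh_eq, Real.cosh_eq, hx]
  generalize Real.exp (-x) = u at hp
  have : 1 + u ^ 2 ≠ 0 := by positivity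
  have h3 : u⁻¹ + u = (1 + u ^ 2) / u := by field_simp
  have h4 : u⁻¹ - u = (1 - u ^ 2) / u := by field_simp
  rw [h3, h4]
  field_simp
  ring

/-- If `β ≠ 0`, the Stan activation function `σ_β(x) = tanh x + β·x·tanh x` does not
saturate: its derivative does not tend to `0` as `x → +∞` nor as `x → −∞`. -/
theorem stan_not_saturating (β : ℝ) (hβ : β ≠ 0) :
    ¬ Filter.Tendsto (deriv (fun x : ℝ => Real.tanh x + β * x * Real.tanh x))
        Filter.atTop (nhds 0) ∧
    ¬ Filter.Tendsto (deriv (fun x : ℝ => Real.tanh x + β * x * Real.tanh x))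
        Filter.atBot (nhds 0) := by
  rw [funext (stan_deriv_aux β)]
  constructor
  · intro h
    exact hβ (tendsto_nhds_unique (stan_tendsto_aux β) h)
  · intro h
    have h' := h.comp Filter.tendsto_neg_atTop_atBot
    have h2 := stan_tendsto_aux (-β)
    refine hβ (neg_eq_zero.1 (tendsto_nhds_unique h2 (h'.congr fun x => ?_)))
    simp [Real.cosh_neg, Real.tanh_neg]
end

section
/- (Euler-type identity, finite-sum version.) Fix n ∈ ℕ, N ∈ ℕ with N ≥ 1, vectors z₁, …, z_N ∈ ℝⁿ, differentiable functions g₁, …, g_N : ℝ → ℝ, and γ ∈ ℝ. Define J : ℝⁿ × ℝ × ℝ → ℝ by J(w, b, β) = (1/N)·Σ_{j=1}^{N} g_j(β·(⟨w, z_j⟩ + b)) + γ·β². Then at every point (w, b, β), β·(∂J/∂β)(w,b,β) = ⟨w, ∇_w J(w,b,β)⟩ + b·(∂J/∂b)(w,b,β) + 2·γ·β². -/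
open RealInnerProductSpace

/-- Euler-type identity, finite-sum version: for
`J(w,b,β) = (1/N)·Σ_{j} g_j(β·(⟪w, z_j⟫ + b)) + γ·β²` with each `g_j` differentiable,
`β·∂J/∂β = ⟪w, ∇_w J⟫ + b·∂J/∂b + 2·γ·β²` at every point `(w,b,β)`. -/
theorem euler_identity_self_scaled_neuron_sum
    (n N : ℕ) (hN : 1 ≤ N) (z : Fin N → EuclideanSpace ℝ (Fin n))
    (g : Fin N → ℝ → ℝ) (hg : ∀ j, Differentiable ℝ (g j))
    (γ : ℝ) (J : EuclideanSpace ℝ (Fin n) → ℝ → ℝ → ℝ)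
    (hJ : ∀ w b β, J w b β
      = (1 / (N : ℝ)) * ∑ j : Fin N, g j (β * (⟪w, z j⟫ + b)) + γ * β ^ 2)
    (w : EuclideanSpace ℝ (Fin n)) (b β : ℝ) :
    β * deriv (fun β' => J w b β') β
      = ⟪w, gradient (fun w' => J w' b β) w⟫
        + b * deriv (fun b' => J w b' β) b + 2 * γ * β ^ 2 := by
  have h1 : HasDerivAt (fun β' => J w b β')
      ((1 / (N : ℝ)) * ∑ j : Fin N,
        deriv (g j) (β * (⟪w, z j⟫ + b)) * (1 * (⟪w, z j⟫ + b)) + γ * (2 * β)) β := by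
    simp only [hJ]
    refine HasDerivAt.add (HasDerivAt.const_mul _ (HasDerivAt.fun_sum fun j _ => ?_)) ?_
    · exact HasDerivAt.comp β (hg j _).hasDerivAt ((hasDerivAt_id β).mul_const _)
    · simpa using (hasDerivAt_pow 2 β).const_mul γ
  have h2 : HasDerivAt (fun b' => J w b' β)
      ((1 / (N : ℝ)) * ∑ j : Fin N,
        deriv (g j) (β * (⟪w, z j⟫ + b)) * (β * 1)) b := by
    simp only [hJ]
    refine HasDerivAt.add_const _ (HasDerivAt.const_mul _ (HasDerivAt.fun_sum fun j _ => ?_))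
    exact HasDerivAt.comp b (hg j _).hasDerivAt (((hasDerivAt_id b).const_add _).const_mul _)
  have h3 : HasFDerivAt (fun w' => J w' b β)
      ((1 / (N : ℝ)) • ∑ j : Fin N,
        deriv (g j) (β * (⟪w, z j⟫ + b)) • (β • innerSL ℝ (z j))) w := by
    simp only [hJ]
    refine HasFDerivAt.add_const _ (HasFDerivAt.const_mul (HasFDerivAt.fun_sum fun j _ => ?_) _)
    have h : HasFDerivAt (fun w' : EuclideanSpace ℝ (Fin n) => ⟪w', z j⟫)
        (innerSL ℝ (z j)) w := by
      have := (innerSL ℝ (z j)).hasFDerivAt (x := w)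
      refine this.congr_of_eventuallyEq (Filter.Eventually.of_forall fun x => ?_)
      simp [real_inner_comm]
    exact HasDerivAt.comp_hasFDerivAt w (hg j _).hasDerivAt ((h.add_const b).const_mul β)
  rw [h1.deriv, h2.deriv, real_inner_comm, gradient, InnerProductSpace.toDual_symm_apply,
    h3.fderiv]
  simp only [ContinuousLinearMap.smul_apply, ContinuousLinearMap.sum_apply, innerSL_apply_apply,
    smul_eq_mul, Finset.mul_sum, mul_add, ← Finset.sum_add_distrib]
  rw [← add_left_inj (-(2 * γ * β ^ 2))]
  ring_nf
  refine Finset.sum_congr rfl fun j _ => ?_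
  rw [real_inner_comm w (z j), add_comm (β * b)]
  ring
end

section
/- (Stationary points force the scale parameter to vanish.) Fix n ∈ ℕ, N ∈ ℕ with N ≥ 1, vectors z₁, …, z_N ∈ ℝⁿ, differentiable functions g₁, …, g_N : ℝ → ℝ, and γ > 0. Define J : ℝⁿ × ℝ × ℝ → ℝ by J(w, b, β) = (1/N)·Σ_{j=1}^{N} g_j(β·(⟨w, z_j⟩ + b)) + γ·β². If (w, b, β) is a stationary point of J, i.e. the total (Fréchet) derivative of J vanishes at (w, b, β), then β = 0. -/
open RealInnerProductSpace

/-- Stationary points force the scale parameter to vanish: if `γ > 0` and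
`J(w,b,β) = (1/N)·Σ_j g_j(β·(⟪w, z_j⟫ + b)) + γ·β²` with each `g_j` differentiable,
then any point `(w,b,β)` where the total derivative of `J` vanishes satisfies `β = 0`. -/
theorem stationary_point_scale_vanishes
    (n N : ℕ) (hN : 1 ≤ N) (z : Fin N → EuclideanSpace ℝ (Fin n))
    (g : Fin N → ℝ → ℝ) (hg : ∀ j, Differentiable ℝ (g j))
    (γ : ℝ) (hγ : 0 < γ)
    (J : EuclideanSpace ℝ (Fin n) × ℝ × ℝ → ℝ)
    (hJ : ∀ p : EuclideanSpace ℝ (Fin n) × ℝ × ℝ, J p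
      = (1 / (N : ℝ)) * ∑ j : Fin N, g j (p.2.2 * (⟪p.1, z j⟫ + p.2.1)) + γ * p.2.2 ^ 2)
    (w : EuclideanSpace ℝ (Fin n)) (b β : ℝ)
    (hstat : fderiv ℝ J (w, b, β) = 0) :
    β = 0 := by
  have hd : Differentiable ℝ J := by
    have : J = fun p => (1 / (N : ℝ)) * ∑ j : Fin N, g j (p.2.2 * (⟪p.1, z j⟫ + p.2.1))
        + γ * p.2.2 ^ 2 := funext hJ
    rw [this]
    have h1 : ∀ j, Differentiable ℝ
        (fun p : EuclideanSpace ℝ (Fin n) × ℝ × ℝ => g j (p.2.2 * (⟪p.1, z j⟫ + p.2.1))) := by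
      intro j
      have h2 : Differentiable ℝ
          (fun p : EuclideanSpace ℝ (Fin n) × ℝ × ℝ => p.2.2 * (⟪p.1, z j⟫ + p.2.1)) := by
        have h3 : Differentiable ℝ
            (fun p : EuclideanSpace ℝ (Fin n) × ℝ × ℝ => (⟪p.1, z j⟫ : ℝ)) :=
          differentiable_fst.inner ℝ (differentiable_const _)
        fun_prop
      exact (hg j).comp h2
    have h4 : Differentiable ℝ (fun p : EuclideanSpace ℝ (Fin n) × ℝ × ℝ =>
        ∑ j : Fin N, g j (p.2.2 * (⟪p.1, z j⟫ + p.2.1))) :=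
      Differentiable.fun_sum fun j _ => h1 j
    fun_prop
  -- move along the scaling orbit
  let c : ℝ → EuclideanSpace ℝ (Fin n) × ℝ × ℝ :=
    fun t => (Real.exp (-t) • w, Real.exp (-t) * b, Real.exp t * β)
  have hc0 : c 0 = (w, b, β) := by simp [c]
  have hc : DifferentiableAt ℝ c 0 := by
    simp only [c]
    fun_prop
  have hJ0 : HasFDerivAt J (0 : EuclideanSpace ℝ (Fin n) × ℝ × ℝ →L[ℝ] ℝ) (c 0) := by
    rw [hc0, ← hstat]
    exact (hd _).hasFDerivAt
  have hA : HasDerivAt (fun t => J (c t)) 0 0 := by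
    have h5 := hJ0.comp_hasDerivAt (0 : ℝ) hc.hasDerivAt
    rw [ContinuousLinearMap.zero_apply] at h5
    exact h5
  have hE : (fun t => J (c t)) = fun t => (1 / (N : ℝ)) *
      ∑ j : Fin N, g j (β * (⟪w, z j⟫ + b)) + γ * (Real.exp t * β) ^ 2 := by
    funext t
    rw [hJ]
    have he : Real.exp t * Real.exp (-t) = 1 := by rw [← Real.exp_add]; simp
    congr 2
    refine Finset.sum_congr rfl fun j _ => ?_
    congr 1
    simp only [c, real_inner_smul_left]
    linear_combination (β * (⟪w, z j⟫ + b)) * he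
  rw [hE] at hA
  have hB := ((((Real.hasDerivAt_exp 0).mul_const β).pow 2).const_mul γ).const_add
    ((1 / (N : ℝ)) * ∑ j : Fin N, g j (β * (⟪w, z j⟫ + b)))
  have h := hA.unique hB
  simp at h
  rcases h with h | h
  · exact absurd h hγ.ne'
  · exact h
end

section
/- (No spurious stationary points, single-neuron form of Theorem 1.) Fix n ∈ ℕ, N ∈ ℕ with N ≥ 1, vectors z₁, …, z_N ∈ ℝⁿ, differentiable functions g₁, …, g_N : ℝ → ℝ, and γ > 0. Define J : ℝⁿ × ℝ × ℝ → ℝ by J(w, b, β) = (1/N)·Σ_{j=1}^{N} g_j(β·(⟨w, z_j⟩ + b)) + γ·β². Then every stationary point (w, b, β) of J (a point where the total derivative of J vanishes) satisfies J(w, b, β) = J(0, 0, 0) = (1/N)·Σ_{j=1}^{N} g_j(0). In particular, there is no stationary point (w, b, β) with J(w, b, β) < J(0, 0, 0). -/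
open RealInnerProductSpace

/-- No spurious stationary points, single-neuron form: if `γ > 0` and
`J(w,b,β) = (1/N)·Σ_j g_j(β·(⟪w, z_j⟫ + b)) + γ·β²` with each `g_j` differentiable,
then every stationary point `(w,b,β)` of `J` satisfies
`J(w,b,β) = J(0,0,0) = (1/N)·Σ_j g_j(0)`; in particular no stationary point has
value below `J(0,0,0)`. -/
theorem no_spurious_stationary_points
    (n N : ℕ) (hN : 1 ≤ N) (z : Fin N → EuclideanSpace ℝ (Fin n))
    (g : Fin N → ℝ → ℝ) (hg : ∀ j, Differentiable ℝ (g j))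
    (γ : ℝ) (hγ : 0 < γ)
    (J : EuclideanSpace ℝ (Fin n) × ℝ × ℝ → ℝ)
    (hJ : ∀ p : EuclideanSpace ℝ (Fin n) × ℝ × ℝ, J p
      = (1 / (N : ℝ)) * ∑ j : Fin N, g j (p.2.2 * (⟪p.1, z j⟫ + p.2.1)) + γ * p.2.2 ^ 2)
    (w : EuclideanSpace ℝ (Fin n)) (b β : ℝ)
    (hstat : fderiv ℝ J (w, b, β) = 0) :
    J (w, b, β) = J (0, 0, 0) ∧
    J (0, 0, 0) = (1 / (N : ℝ)) * ∑ j : Fin N, g j 0 ∧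
    ¬ J (w, b, β) < J (0, 0, 0) := by
  have hdiff : Differentiable ℝ J := by
    have h : J = fun p => (1 / (N : ℝ)) * ∑ j : Fin N, g j (p.2.2 * (⟪p.1, z j⟫ + p.2.1))
        + γ * p.2.2 ^ 2 := funext hJ
    rw [h]
    have h1 : ∀ j, Differentiable ℝ (fun p : EuclideanSpace ℝ (Fin n) × ℝ × ℝ =>
        g j (p.2.2 * (⟪p.1, z j⟫ + p.2.1))) := by
      intro j
      refine (hg j).comp ?_
      have h2 : Differentiable ℝ (fun p : EuclideanSpace ℝ (Fin n) × ℝ × ℝ => ⟪p.1, z j⟫) :=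
        differentiable_fst.inner ℝ (differentiable_const _)
      fun_prop
    have h3 : Differentiable ℝ (fun p : EuclideanSpace ℝ (Fin n) × ℝ × ℝ =>
        ∑ j : Fin N, g j (p.2.2 * (⟪p.1, z j⟫ + p.2.1))) :=
      Differentiable.fun_sum (fun j _ => h1 j)
    have h4 : Differentiable ℝ (fun p : EuclideanSpace ℝ (Fin n) × ℝ × ℝ => γ * p.2.2 ^ 2) := by
      fun_prop
    exact (h3.const_mul _).add h4
  have hβ : β = 0 := by
    let c : ℝ → EuclideanSpace ℝ (Fin n) × ℝ × ℝ :=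
      fun t => (Real.exp (-t) • w, Real.exp (-t) * b, Real.exp t * β)
    have hc0 : c 0 = (w, b, β) := by simp [c]
    have hc : DifferentiableAt ℝ c 0 := by
      simp only [c]
      fun_prop
    have hJ0 : HasFDerivAt J (0 : EuclideanSpace ℝ (Fin n) × ℝ × ℝ →L[ℝ] ℝ) (c 0) := by
      rw [hc0, ← hstat]
      exact (hdiff _).hasFDerivAt
    have hd := hJ0.comp_hasDerivAt (0 : ℝ) hc.hasDerivAt
    have hform : J ∘ c = fun t => (1 / (N : ℝ)) * ∑ j : Fin N, g j (β * (⟪w, z j⟫ + b))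
        + γ * (Real.exp t * β) ^ 2 := by
      funext t
      have key : ∀ j, Real.exp t * β * (Real.exp (-t) * ⟪w, z j⟫ + Real.exp (-t) * b)
          = β * (⟪w, z j⟫ + b) := by
        intro j
        have he : Real.exp t * Real.exp (-t) = 1 := by
          rw [← Real.exp_add]; simp
        linear_combination β * (⟪w, z j⟫ + b) * he
      simp only [Function.comp, hJ, c, real_inner_smul_left, key]
    rw [hform] at hd
    have hd2 := ((((Real.hasDerivAt_exp 0).mul_const β).pow 2).const_mul γ).const_add
      ((1 / (N : ℝ)) * ∑ j : Fin N, g j (β * (⟪w, z j⟫ + b)))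
    have hu := hd.unique hd2
    simp at hu
    rcases hu with h | h
    · exact absurd h hγ.ne'
    · simpa using h
  have e0 : J (0, 0, 0) = (1 / (N : ℝ)) * ∑ j : Fin N, g j 0 := by
    rw [hJ]; simp
  have e1 : J (w, b, β) = J (0, 0, 0) := by
    rw [e0, hJ]; simp [hβ]
  exact ⟨e1, e0, by rw [e1]; exact lt_irrefl _⟩
end
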